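/- Optimal direct product theorem, lower bound: there is a universal constant c > 0 such that for every (possibly partial) function f : X → {0,1} with X ⊆ {0,1}^m, every success probability γ ∈ (1/2, 1), and every integer n ≥ 1, the worst-case randomized query complexity of the n-fold direct product satisfies R_{γ^n}(f^n) ≥ c·n·R̄̄_γ(f), where R̄̄_γ(f) is the maximum distributional query complexity of f with the success-probability score. -/

import Mathlib

open Finset

/-- Deterministic decision trees querying coordinates `i : ι` of inputs `x : ι → Bool`,
with leaves labelled by elements of `L`. -/
inductive DTree (ι : Type) (L : Type) : Type
  | leaf (lab : L) : DTree ι L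
  | node (i : ι) (t0 : DTree ι L) (t1 : DTree ι L) : DTree ι L

namespace DTree

variable {ι L : Type}

/-- Output label at the leaf reached by input `x`. -/
def out : DTree ι L → (ι → Bool) → L
  | .leaf lab, _ => lab
  | .node i t0 t1, x => if x i then out t1 x else out t0 x

/-- Number of queries made on input `x` (depth of the leaf reached by `x`). -/
def cost : DTree ι L → (ι → Bool) → ℕ
  | .leaf _, _ => 0
  | .node i t0 t1, x => (if x i then cost t1 x else cost t0 x) + 1

/-- Maximum leaf depth of the tree. -/
def depth : DTree ι L → ℕ
  | .leaf _ => 0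
  | .node _ t0 t1 => max (depth t0) (depth t1) + 1

/-- The set of inputs reaching the same leaf as input `x`. -/
def leafSet : DTree ι L → (ι → Bool) → Set (ι → Bool)
  | .leaf _, _ => Set.univ
  | .node i t0 t1, x => {y | y i = x i} ∩ (if x i then leafSet t1 x else leafSet t0 x)

/-- Every leaf label of the tree satisfies the predicate `P`. -/
def allLabels : DTree ι L → (L → Prop) → Prop
  | .leaf lab, P => P lab
  | .node _ t0 t1, P => allLabels t0 P ∧ allLabels t1 P

end DTree

/-- A randomized query algorithm: a finitely supported probability distribution over
deterministic decision trees. -/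
structure RandAlg (ι : Type) (L : Type) where
  k : ℕ
  p : Fin k → ℝ
  T : Fin k → DTree ι L
  p_nonneg : ∀ j, 0 ≤ p j
  p_sum : ∑ j, p j = 1

/-- A probability distribution on inputs, supported inside the domain `X`. -/
structure InputDist (ι : Type) [Fintype ι] [DecidableEq ι] (X : Set (ι → Bool)) where
  μ : (ι → Bool) → ℝ
  nonneg : ∀ x, 0 ≤ μ x
  sum_one : ∑ x, μ x = 1
  supp : ∀ x, x ∉ X → μ x = 0

/-- A score function `φ : [0,1] → [1/2,1]`. -/
structure ScoreFun where
  φ : ℝ → ℝ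
  continuous : ContinuousOn φ (Set.Icc 0 1)
  half_le : ∀ p ∈ Set.Icc (0:ℝ) 1, 1 / 2 ≤ φ p
  le_one : ∀ p ∈ Set.Icc (0:ℝ) 1, φ p ≤ 1
  map_zero : φ 0 = 1
  map_one : φ 1 = 1
  map_half : φ (1 / 2) = 1 / 2
  symm : ∀ p ∈ Set.Icc (0:ℝ) 1, φ (1 - p) = φ p
  mono : MonotoneOn φ (Set.Icc (1 / 2) 1)

section Defs

variable {ι L : Type} [Fintype ι] [DecidableEq ι]

/-- Mass of a set of inputs under the weight function `μ`. -/
noncomputable def mass (μ : (ι → Bool) → ℝ) (S : Set (ι → Bool)) : ℝ :=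
  ∑ x, Set.indicator S μ x

/-- Score `φ(μ(ℓ₁)/μ(ℓ))` of the leaf `ℓ` reached by `x` in the tree `t`. -/
noncomputable def leafScore (S : ScoreFun) (f : (ι → Bool) → Bool) (μ : (ι → Bool) → ℝ)
    (t : DTree ι L) (x : ι → Bool) : ℝ :=
  S.φ (mass μ (t.leafSet x ∩ {y | f y = true}) / mass μ (t.leafSet x))

/-- Score of a randomized algorithm: `E_{D∼R, x∼μ}[score(D(x))]`. -/
noncomputable def algScore (S : ScoreFun) (f : (ι → Bool) → Bool) (μ : (ι → Bool) → ℝ)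
    (R : RandAlg ι L) : ℝ :=
  ∑ j, R.p j * ∑ x, μ x * leafScore S f μ (R.T j) x

/-- Expected cost `E_{D∼R, x∼μ}[cost(D(x))]`. -/
noncomputable def expCost (μ : (ι → Bool) → ℝ) (R : RandAlg ι L) : ℝ :=
  ∑ j, R.p j * ∑ x, μ x * ((R.T j).cost x : ℝ)

/-- Score-weighted cost `E[score(D(x))·cost(D(x))] / E[score(D(x))]`. -/
noncomputable def scost (S : ScoreFun) (f : (ι → Bool) → Bool) (μ : (ι → Bool) → ℝ)
    (R : RandAlg ι L) : ℝ :=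
  (∑ j, R.p j * ∑ x, μ x * (leafScore S f μ (R.T j) x * ((R.T j).cost x : ℝ))) /
    algScore S f μ R

/-- Discounted score `E[score(D(x))·e^{-α·cost(D(x))}]`. -/
noncomputable def dScore (S : ScoreFun) (f : (ι → Bool) → Bool) (μ : (ι → Bool) → ℝ)
    (α : ℝ) (R : RandAlg ι L) : ℝ :=
  ∑ j, R.p j * ∑ x, μ x *
    (leafScore S f μ (R.T j) x * Real.exp (-(α * ((R.T j).cost x : ℝ))))

/-- Maximum discounted score `DS_α^μ(f)`. -/
noncomputable def DS (S : ScoreFun) (f : (ι → Bool) → Bool) (μ : (ι → Bool) → ℝ)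
    (α : ℝ) : ℝ :=
  ⨆ R : RandAlg ι Unit, dScore S f μ α R

/-- Distributional score-weighted query complexity `sR̄̄_γ^μ(f)`. -/
noncomputable def sRdist (S : ScoreFun) (f : (ι → Bool) → Bool) (μ : (ι → Bool) → ℝ)
    (γ : ℝ) : ℝ :=
  sInf {c | ∃ R : RandAlg ι Unit, γ ≤ algScore S f μ R ∧ scost S f μ R = c}

/-- Distributional query complexity `R̄̄_γ^μ(f)` (expected cost). -/
noncomputable def Rdist (S : ScoreFun) (f : (ι → Bool) → Bool) (μ : (ι → Bool) → ℝ)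
    (γ : ℝ) : ℝ :=
  sInf {c | ∃ R : RandAlg ι Unit, γ ≤ algScore S f μ R ∧ expCost μ R = c}

/-- Maximum score-weighted distributional query complexity `sR̄̄_γ(f)`. -/
noncomputable def sRmax (S : ScoreFun) (X : Set (ι → Bool)) (f : (ι → Bool) → Bool)
    (γ : ℝ) : ℝ :=
  ⨆ μ : InputDist ι X, sRdist S f μ.μ γ

/-- Maximum distributional query complexity `R̄̄_γ(f)`. -/
noncomputable def Rmax (S : ScoreFun) (X : Set (ι → Bool)) (f : (ι → Bool) → Bool)
    (γ : ℝ) : ℝ :=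
  ⨆ μ : InputDist ι X, Rdist S f μ.μ γ

/-- Success-probability score `max{μ(ℓ₀),μ(ℓ₁)}/μ(ℓ)` of the leaf reached by `x`. -/
noncomputable def succLeafScore (f : (ι → Bool) → Bool) (μ : (ι → Bool) → ℝ)
    (t : DTree ι L) (x : ι → Bool) : ℝ :=
  max (mass μ (t.leafSet x ∩ {y | f y = false})) (mass μ (t.leafSet x ∩ {y | f y = true})) /
    mass μ (t.leafSet x)

/-- Success-probability score of a randomized algorithm. -/
noncomputable def succAlgScore (f : (ι → Bool) → Bool) (μ : (ι → Bool) → ℝ)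
    (R : RandAlg ι L) : ℝ :=
  ∑ j, R.p j * ∑ x, μ x * succLeafScore f μ (R.T j) x

/-- Distributional query complexity with the success-probability score. -/
noncomputable def succRdist (f : (ι → Bool) → Bool) (μ : (ι → Bool) → ℝ) (γ : ℝ) : ℝ :=
  sInf {c | ∃ R : RandAlg ι Unit, γ ≤ succAlgScore f μ R ∧ expCost μ R = c}

/-- Maximum distributional query complexity `R̄̄_γ(f)` with the success-probability score. -/
noncomputable def succRmax (X : Set (ι → Bool)) (f : (ι → Bool) → Bool) (γ : ℝ) : ℝ :=
  ⨆ μ : InputDist ι X, succRdist f μ.μ γ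

/-- The fraction `q = μ(ℓ₁)/μ(ℓ)` at the leaf reached by `x`. -/
noncomputable def leafBias (f : (ι → Bool) → Bool) (μ : (ι → Bool) → ℝ)
    (t : DTree ι L) (x : ι → Bool) : ℝ :=
  mass μ (t.leafSet x ∩ {y | f y = true}) / mass μ (t.leafSet x)

/-- Hellinger loss `E[2·√(q(1-q))]` of a randomized algorithm. -/
noncomputable def helLossAlg (f : (ι → Bool) → Bool) (μ : (ι → Bool) → ℝ)
    (R : RandAlg ι L) : ℝ :=
  ∑ j, R.p j * ∑ x, μ x *
    (2 * Real.sqrt (leafBias f μ (R.T j) x * (1 - leafBias f μ (R.T j) x)))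

/-- Hellinger score `E[1 - √(q(1-q))]` of a randomized algorithm. -/
noncomputable def helScoreAlg (f : (ι → Bool) → Bool) (μ : (ι → Bool) → ℝ)
    (R : RandAlg ι L) : ℝ :=
  ∑ j, R.p j * ∑ x, μ x *
    (1 - Real.sqrt (leafBias f μ (R.T j) x * (1 - leafBias f μ (R.T j) x)))

/-- `R̄̄_{Hel↓,ε}(f)`: maximum distributional complexity at Hellinger loss `ε`. -/
noncomputable def RmaxHelLoss (X : Set (ι → Bool)) (f : (ι → Bool) → Bool) (ε : ℝ) : ℝ :=
  ⨆ μ : InputDist ι X,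
    sInf {c | ∃ R : RandAlg ι Unit, helLossAlg f μ.μ R ≤ ε ∧ expCost μ.μ R = c}

/-- `R̄̄_{Hel,γ}(f)`: maximum distributional complexity at Hellinger score `γ`. -/
noncomputable def RmaxHel (X : Set (ι → Bool)) (f : (ι → Bool) → Bool) (γ : ℝ) : ℝ :=
  ⨆ μ : InputDist ι X,
    sInf {c | ∃ R : RandAlg ι Unit, γ ≤ helScoreAlg f μ.μ R ∧ expCost μ.μ R = c}

/-- Binary entropy function. -/
noncomputable def binEnt (p : ℝ) : ℝ :=
  -(p * Real.logb 2 p) - (1 - p) * Real.logb 2 (1 - p)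

/-- Exponential-entropy score `E[1 - (1/2)·2^{-h(q)}]` of a randomized algorithm. -/
noncomputable def entScoreAlg (f : (ι → Bool) → Bool) (μ : (ι → Bool) → ℝ)
    (R : RandAlg ι L) : ℝ :=
  ∑ j, R.p j * ∑ x, μ x *
    (1 - (1 / 2) * (2:ℝ) ^ (-(binEnt (leafBias f μ (R.T j) x))))

/-- `R̄̄_{Ent,γ}(f)`: maximum distributional complexity at exponential-entropy score `γ`. -/
noncomputable def RmaxEnt (X : Set (ι → Bool)) (f : (ι → Bool) → Bool) (γ : ℝ) : ℝ :=
  ⨆ μ : InputDist ι X,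
    sInf {c | ∃ R : RandAlg ι Unit, γ ≤ entScoreAlg f μ.μ R ∧ expCost μ.μ R = c}

end Defs

section WorstCase

variable {ι L : Type}

open Classical in
/-- Worst-case randomized query complexity for a generic task: minimum, over randomized
algorithms whose leaf labels satisfy `labelOK` and which on every input `x ∈ X` output a
label `z` with `good x z` with probability at least `δ`, of the maximum leaf depth over
the trees in the support. -/
noncomputable def RwcTask (X : Set (ι → Bool)) (good : (ι → Bool) → L → Prop)
    (labelOK : L → Prop) (δ : ℝ) : ℕ :=
  sInf {d : ℕ | ∃ R : RandAlg ι L,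
    (∀ j, R.p j ≠ 0 → (R.T j).allLabels labelOK) ∧
    (∀ x ∈ X, δ ≤ ∑ j, if good x ((R.T j).out x) then R.p j else 0) ∧
    ∀ j, R.p j ≠ 0 → (R.T j).depth ≤ d}

/-- Worst-case randomized query complexity `R_δ(f)` of a (partial) Boolean function. -/
noncomputable def Rwc (X : Set (ι → Bool)) (f : (ι → Bool) → Bool) (δ : ℝ) : ℕ :=
  RwcTask X (fun x b => b = f x) (fun _ : Bool => True) δ

end WorstCase

section Product

variable {m n : ℕ} {L : Type}

/-- The `i`-th block of an input to the `n`-fold direct product. -/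
def block (x : Fin n × Fin m → Bool) (i : Fin n) : Fin m → Bool := fun j => x (i, j)

/-- The product domain `Xⁿ`. -/
def Xpow (n : ℕ) (X : Set (Fin m → Bool)) : Set (Fin n × Fin m → Bool) :=
  {x | ∀ i, block x i ∈ X}

/-- The `n`-fold direct product `fⁿ`. -/
def fpow (f : (Fin m → Bool) → Bool) (x : Fin n × Fin m → Bool) : Fin n → Bool :=
  fun i => f (block x i)

/-- The product distribution `μⁿ`. -/
noncomputable def prodMu (μ : (Fin m → Bool) → ℝ) (x : Fin n × Fin m → Bool) : ℝ :=
  ∏ i, μ (block x i)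

/-- The `i`-th factor `ℓ^(i)` of the (product) leaf reached by `x` in a decision tree for `fⁿ`. -/
def blockSet (t : DTree (Fin n × Fin m) L) (x : Fin n × Fin m → Bool) (i : Fin n) :
    Set (Fin m → Bool) :=
  {y | (fun q : Fin n × Fin m => if q.1 = i then y q.2 else x q) ∈ t.leafSet x}

/-- Score of a leaf of a tree for `fⁿ` under `μⁿ`: the product of the scores of its factors. -/
noncomputable def prodLeafScore (S : ScoreFun) (f : (Fin m → Bool) → Bool)
    (μ : (Fin m → Bool) → ℝ) (t : DTree (Fin n × Fin m) L) (x : Fin n × Fin m → Bool) : ℝ :=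
  ∏ i, S.φ (mass μ (blockSet t x i ∩ {y | f y = true}) / mass μ (blockSet t x i))

/-- Score of a randomized algorithm for `fⁿ` under `μⁿ`. -/
noncomputable def algScoreN (S : ScoreFun) (f : (Fin m → Bool) → Bool)
    (μ : (Fin m → Bool) → ℝ) (R : RandAlg (Fin n × Fin m) L) : ℝ :=
  ∑ j, R.p j * ∑ x, prodMu μ x * prodLeafScore S f μ (R.T j) x

/-- Score-weighted cost of a randomized algorithm for `fⁿ` under `μⁿ`. -/
noncomputable def scostN (S : ScoreFun) (f : (Fin m → Bool) → Bool)
    (μ : (Fin m → Bool) → ℝ) (R : RandAlg (Fin n × Fin m) L) : ℝ :=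
  (∑ j, R.p j * ∑ x, prodMu μ x * (prodLeafScore S f μ (R.T j) x * ((R.T j).cost x : ℝ))) /
    algScoreN S f μ R

/-- Discounted score of a randomized algorithm for `fⁿ` under `μⁿ`. -/
noncomputable def dScoreN (S : ScoreFun) (f : (Fin m → Bool) → Bool)
    (μ : (Fin m → Bool) → ℝ) (α : ℝ) (R : RandAlg (Fin n × Fin m) L) : ℝ :=
  ∑ j, R.p j * ∑ x, prodMu μ x *
    (prodLeafScore S f μ (R.T j) x * Real.exp (-(α * ((R.T j).cost x : ℝ))))

/-- Maximum discounted score `DS_α^{μⁿ}(fⁿ)`. -/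
noncomputable def DSN (S : ScoreFun) (f : (Fin m → Bool) → Bool)
    (μ : (Fin m → Bool) → ℝ) (α : ℝ) (n : ℕ) : ℝ :=
  ⨆ R : RandAlg (Fin n × Fin m) Unit, dScoreN S f μ α R

/-- Distributional score-weighted query complexity `sR̄̄_γ^{μⁿ}(fⁿ)`. -/
noncomputable def sRdistN (S : ScoreFun) (f : (Fin m → Bool) → Bool)
    (μ : (Fin m → Bool) → ℝ) (γ : ℝ) (n : ℕ) : ℝ :=
  sInf {c | ∃ R : RandAlg (Fin n × Fin m) Unit,
    γ ≤ algScoreN S f μ R ∧ scostN S f μ R = c}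

/-- Worst-case randomized query complexity `R_δ(fⁿ)` of computing `fⁿ` exactly. -/
noncomputable def RwcN (X : Set (Fin m → Bool)) (f : (Fin m → Bool) → Bool)
    (n : ℕ) (δ : ℝ) : ℕ :=
  RwcTask (Xpow n X) (fun x z => z = fpow f x) (fun _ : Fin n → Bool => True) δ

/-- Success-probability score `max_z μ(ℓ ∩ (fⁿ)⁻¹(z))/μ(ℓ)` of a leaf of a tree for `fⁿ`
under an arbitrary distribution `μ` on `Xⁿ`. -/
noncomputable def succLeafScoreN (f : (Fin m → Bool) → Bool)
    (μ : (Fin n × Fin m → Bool) → ℝ) (t : DTree (Fin n × Fin m) L)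
    (x : Fin n × Fin m → Bool) : ℝ :=
  (⨆ z : Fin n → Bool, mass μ (t.leafSet x ∩ {y | fpow f y = z})) / mass μ (t.leafSet x)

/-- Success-probability score of a randomized algorithm for `fⁿ`. -/
noncomputable def succAlgScoreN (f : (Fin m → Bool) → Bool)
    (μ : (Fin n × Fin m → Bool) → ℝ) (R : RandAlg (Fin n × Fin m) L) : ℝ :=
  ∑ j, R.p j * ∑ x, μ x * succLeafScoreN f μ (R.T j) x

/-- Score-weighted cost of a randomized algorithm for `fⁿ` (success-probability score). -/
noncomputable def succScostN (f : (Fin m → Bool) → Bool)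
    (μ : (Fin n × Fin m → Bool) → ℝ) (R : RandAlg (Fin n × Fin m) L) : ℝ :=
  (∑ j, R.p j * ∑ x, μ x * (succLeafScoreN f μ (R.T j) x * ((R.T j).cost x : ℝ))) /
    succAlgScoreN f μ R

/-- Maximum score-weighted distributional query complexity `sR̄̄_δ(fⁿ)`
(success-probability score). -/
noncomputable def succSRmaxN (X : Set (Fin m → Bool)) (f : (Fin m → Bool) → Bool)
    (n : ℕ) (δ : ℝ) : ℝ :=
  ⨆ μ : InputDist (Fin n × Fin m) (Xpow n X),
    sInf {c | ∃ R : RandAlg (Fin n × Fin m) Unit,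
      δ ≤ succAlgScoreN f μ.μ R ∧ succScostN f μ.μ R = c}

/-- Worst-case randomized query complexity of the list-decoding task `LD_ℓⁿ ∘ f`. -/
noncomputable def RwcLD (X : Set (Fin m → Bool)) (f : (Fin m → Bool) → Bool)
    (n ℓ : ℕ) (δ : ℝ) : ℕ :=
  RwcTask (Xpow n X) (fun x S => fpow f x ∈ S)
    (fun S : Finset (Fin n → Bool) => S.card = 2 ^ (n - ℓ)) δ

open Classical in
/-- Worst-case randomized query complexity of the threshold task `Thr_kⁿ ∘ f`. -/
noncomputable def RwcThr (X : Set (Fin m → Bool)) (f : (Fin m → Bool) → Bool)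
    (n k : ℕ) (δ : ℝ) : ℕ :=
  RwcTask (Xpow n X)
    (fun x z => k ≤ (Finset.univ.filter fun i => z i = fpow f x i).card)
    (fun _ : Fin n → Bool => True) δ

open Classical in
/-- Worst-case randomized query complexity of the labelled threshold task `Label_kⁿ ∘ f`. -/
noncomputable def RwcLabel (X : Set (Fin m → Bool)) (f : (Fin m → Bool) → Bool)
    (n k : ℕ) (δ : ℝ) : ℕ :=
  RwcTask (Xpow n X)
    (fun x z => ∀ i b, z i = some b → fpow f x i = b)
    (fun z : Fin n → Option Bool =>
      (Finset.univ.filter fun i => (z i).isSome).card = k) δ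

end Product

theorem mem_leafSet_self {ι L : Type} (t : DTree ι L) (x : ι → Bool) : x ∈ t.leafSet x := by
  induction t with
  | leaf a => trivial
  | node i t0 t1 ih0 ih1 =>
    refine ⟨rfl, ?_⟩
    split_ifs
    exacts [ih1, ih0]

/-- There is a tree whose leaves determine the input on `s`, and which computes any given
function of these coordinates. -/
theorem exists_tree_of_dependsOn {ι L : Type} [DecidableEq ι] (s : Finset ι) : ∀ g : (ι → Bool) → L,
    (∀ x y, (∀ i ∈ s, x i = y i) → g x = g y) →
    ∃ t : DTree ι L, ∀ x, t.out x = g x ∧ ∀ y ∈ t.leafSet x, ∀ i ∈ s, y i = x i := by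
  induction s using Finset.induction_on with
  | empty =>
    intro g hg
    exact ⟨.leaf (g fun _ => false), fun x => ⟨hg _ _ (by simp), by simp⟩⟩
  | insert i s hi ih =>
    intro g hg
    have key : ∀ b, ∃ t : DTree ι L, ∀ x, t.out x = g (Function.update x i b) ∧
        ∀ y ∈ t.leafSet x, ∀ j ∈ s, y j = x j := by
      intro b
      refine ih (fun x => g (Function.update x i b)) fun x y hxy => hg _ _ fun j hj => ?_
      by_cases hji : j = i
      · subst hji; simp
      · simp [hji, hxy j (Finset.mem_of_mem_insert_of_ne hj hji)]
    obtain ⟨t0, h0⟩ := key false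
    obtain ⟨t1, h1⟩ := key true
    refine ⟨.node i t0 t1, fun x => ?_⟩
    cases h : x i
    · refine ⟨?_, fun y hy => ?_⟩
      · have hu : Function.update x i false = x := by rw [← h, Function.update_eq_self]
        simp [DTree.out, h, (h0 x).1, hu]
      · simp only [DTree.leafSet, h, Set.mem_inter_iff, Set.mem_ofPred_eq, Bool.false_eq_true,
          if_false] at hy
        simpa [h, hy.1] using (h0 x).2 y hy.2
    · refine ⟨?_, fun y hy => ?_⟩
      · have hu : Function.update x i true = x := by rw [← h, Function.update_eq_self]
        simp [DTree.out, h, (h1 x).1, hu]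
      · simp only [DTree.leafSet, h, Set.mem_inter_iff, Set.mem_ofPred_eq, if_true] at hy
        simpa [h, hy.1] using (h1 x).2 y hy.2

/-- The algorithm running `t₁` with probability `p` and `t₀` with probability `1 - p`. -/
noncomputable def mixTwo {ι L : Type} (p : ℝ) (h0 : 0 ≤ p) (h1 : p ≤ 1) (t1 t0 : DTree ι L) :
    RandAlg ι L where
  k := 2
  p := ![p, 1 - p]
  T := ![t1, t0]
  p_nonneg := by
    intro j
    fin_cases j <;> simp [h0, h1]
  p_sum := by simp

theorem sum_mixTwo {ι L : Type} (p : ℝ) (h0 : 0 ≤ p) (h1 : p ≤ 1)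
    (t1 t0 : DTree ι L) (g : DTree ι L → ℝ) :
    ∑ j, (mixTwo p h0 h1 t1 t0).p j * g ((mixTwo p h0 h1 t1 t0).T j) =
      p * g t1 + (1 - p) * g t0 :=
  Fin.sum_univ_two (fun j : Fin 2 => ![p, 1 - p] j * g (![t1, t0] j))

section Restriction

variable {ι L : Type} [Fintype ι] [DecidableEq ι]

/-- The weight function `w` restricted to the inputs `y` with `y i = b`. -/
noncomputable def restrictWt (w : (ι → Bool) → ℝ) (i : ι) (b : Bool) : (ι → Bool) → ℝ :=
  fun y => if y i = b then w y else 0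

/-- Total success score of a deterministic tree under the weight function `w`. -/
noncomputable def treeScore (f : (ι → Bool) → Bool) (w : (ι → Bool) → ℝ) (t : DTree ι L) : ℝ :=
  ∑ x, w x * succLeafScore f w t x

/-- Total cost of a deterministic tree under the weight function `w`. -/
noncomputable def treeCost (w : (ι → Bool) → ℝ) (t : DTree ι L) : ℝ :=
  ∑ x, w x * (t.cost x : ℝ)

/-- Optimal value of the score minus `lam` times the cost, under the weight function `w`. -/
noncomputable def penalizedValue (f : (ι → Bool) → Bool) (lam : ℝ) (w : (ι → Bool) → ℝ) : ℝ :=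
  ⨆ t : DTree ι Unit, treeScore f w t - lam * treeCost w t

theorem restrictWt_nonneg {ι : Type} {w : (ι → Bool) → ℝ} (hw : ∀ x, 0 ≤ w x) (i : ι) (b : Bool)
    (x : ι → Bool) : 0 ≤ restrictWt w i b x := by
  unfold restrictWt
  split_ifs
  exacts [hw x, le_rfl]

theorem sum_restrictWt_mul {ι : Type} [Fintype ι] [DecidableEq ι] (w : (ι → Bool) → ℝ) (i : ι)
    (g : Bool → (ι → Bool) → ℝ) :
    ∑ x, w x * g (x i) x =
      ∑ x, restrictWt w i false x * g false x + ∑ x, restrictWt w i true x * g true x := by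
  rw [← Finset.sum_add_distrib]
  refine Finset.sum_congr rfl fun x _ => ?_
  cases h : x i <;> simp [restrictWt, h]

theorem mass_coord_inter (w : (ι → Bool) → ℝ) (i : ι) (b : Bool) (A : Set (ι → Bool)) :
    mass w ({y | y i = b} ∩ A) = mass (restrictWt w i b) A := by
  classical
  refine Finset.sum_congr rfl fun x _ => ?_
  by_cases h : x i = b <;> simp [Set.indicator_apply, restrictWt, h]

theorem mass_nonneg {w : (ι → Bool) → ℝ} (hw : ∀ x, 0 ≤ w x) (A : Set (ι → Bool)) :
    0 ≤ mass w A :=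
  Finset.sum_nonneg fun x _ => Set.indicator_nonneg (fun y _ => hw y) x

theorem mass_univ (w : (ι → Bool) → ℝ) : mass w Set.univ = ∑ x, w x := by
  simp [mass]

theorem mass_preimage_add (f : (ι → Bool) → Bool) (w : (ι → Bool) → ℝ) :
    mass w {y | f y = false} + mass w {y | f y = true} = ∑ x, w x := by
  classical
  unfold mass
  rw [← Finset.sum_add_distrib]
  refine Finset.sum_congr rfl fun x _ => ?_
  cases h : f x <;> simp [h]

theorem treeScore_leaf (f : (ι → Bool) → Bool) {w : (ι → Bool) → ℝ} (hw : ∀ x, 0 ≤ w x) (a : L) :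
    treeScore f w (.leaf a) = max (mass w {y | f y = false}) (mass w {y | f y = true}) := by
  have h := mass_preimage_add f w
  have h0 := mass_nonneg hw {y | f y = false}
  have h1 := mass_nonneg hw {y | f y = true}
  simp only [treeScore, succLeafScore, DTree.leafSet, Set.univ_inter, ← Finset.sum_mul, mass_univ]
  rcases eq_or_ne (∑ x, w x) 0 with h2 | h2
  · have h3 : mass w {y | f y = false} = 0 := by linarith
    have h4 : mass w {y | f y = true} = 0 := by linarith
    simp [h2, h3, h4]
  · field_simp

theorem treeScore_node (f : (ι → Bool) → Bool) (w : (ι → Bool) → ℝ) (i : ι) (t0 t1 : DTree ι L) :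
    treeScore f w (.node i t0 t1) =
      treeScore f (restrictWt w i false) t0 + treeScore f (restrictWt w i true) t1 := by
  unfold treeScore
  have key := sum_restrictWt_mul w i
    (fun b x => succLeafScore f (restrictWt w i b) (if b then t1 else t0) x)
  simp only [Bool.false_eq_true, if_false, if_true] at key
  rw [← key]
  refine Finset.sum_congr rfl fun x _ => ?_
  cases h : x i <;>
    simp [succLeafScore, DTree.leafSet, h, Set.inter_assoc, mass_coord_inter]

theorem treeCost_leaf (w : (ι → Bool) → ℝ) (a : L) : treeCost w (.leaf a : DTree ι L) = 0 := by
  simp [treeCost, DTree.cost]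

theorem treeCost_node (w : (ι → Bool) → ℝ) (i : ι) (t0 t1 : DTree ι L) :
    treeCost w (.node i t0 t1) =
      treeCost (restrictWt w i false) t0 + treeCost (restrictWt w i true) t1 + ∑ x, w x := by
  unfold treeCost
  have h := sum_restrictWt_mul w i (fun b x => (((if b then t1 else t0).cost x : ℕ) : ℝ))
  simp only [Bool.false_eq_true, if_false, if_true] at h
  rw [← h, ← Finset.sum_add_distrib]
  refine Finset.sum_congr rfl fun x _ => ?_
  cases h : x i <;> simp [DTree.cost, h] <;> ring

theorem treeCost_nonneg {w : (ι → Bool) → ℝ} (hw : ∀ x, 0 ≤ w x) (t : DTree ι L) :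
    0 ≤ treeCost w t :=
  Finset.sum_nonneg fun x _ => mul_nonneg (hw x) (Nat.cast_nonneg _)

theorem sum_restrictWt (w : (ι → Bool) → ℝ) (i : ι) :
    ∑ x, restrictWt w i false x + ∑ x, restrictWt w i true x = ∑ x, w x := by
  simpa using (sum_restrictWt_mul w i (fun _ _ => 1)).symm

theorem treeScore_le (f : (ι → Bool) → Bool) (t : DTree ι L) :
    ∀ {w : (ι → Bool) → ℝ}, (∀ x, 0 ≤ w x) → treeScore f w t ≤ ∑ x, w x := by
  induction t with
  | leaf a =>
    intro w hw
    have h := mass_preimage_add f w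
    have h0 := mass_nonneg hw {y | f y = false}
    have h1 := mass_nonneg hw {y | f y = true}
    rw [treeScore_leaf f hw]
    exact max_le (by linarith) (by linarith)
  | node i t0 t1 ih0 ih1 =>
    intro w hw
    rw [treeScore_node, ← sum_restrictWt w i]
    exact add_le_add (ih0 (restrictWt_nonneg hw i _)) (ih1 (restrictWt_nonneg hw i _))

theorem bddAbove_penalized (f : (ι → Bool) → Bool) {lam : ℝ} (hl : 0 ≤ lam)
    {w : (ι → Bool) → ℝ} (hw : ∀ x, 0 ≤ w x) :
    BddAbove (Set.range fun t : DTree ι Unit => treeScore f w t - lam * treeCost w t) := by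
  refine ⟨∑ x, w x, ?_⟩
  rintro _ ⟨t, rfl⟩
  have h1 := treeScore_le f t hw
  have h2 := mul_nonneg hl (treeCost_nonneg hw t)
  dsimp only
  linarith

instance : Nonempty (DTree ι Unit) := ⟨.leaf ()⟩

theorem mass_preimage_le_penalizedValue (f : (ι → Bool) → Bool) {lam : ℝ} (hl : 0 ≤ lam)
    {w : (ι → Bool) → ℝ} (hw : ∀ x, 0 ≤ w x) (b : Bool) :
    mass w {y | f y = b} ≤ penalizedValue f lam w := by
  have h := le_ciSup (bddAbove_penalized f hl hw) (.leaf ())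
  simp only [treeScore_leaf f hw, treeCost_leaf, mul_zero, sub_zero] at h
  refine le_trans ?_ h
  cases b
  exacts [le_max_left _ _, le_max_right _ _]

theorem penalizedValue_nonneg (f : (ι → Bool) → Bool) {lam : ℝ} (hl : 0 ≤ lam)
    {w : (ι → Bool) → ℝ} (hw : ∀ x, 0 ≤ w x) : 0 ≤ penalizedValue f lam w :=
  (mass_nonneg hw _).trans (mass_preimage_le_penalizedValue f hl hw true)

theorem penalizedValue_restrict_add_le (f : (ι → Bool) → Bool) {lam : ℝ} (hl : 0 ≤ lam)
    {w : (ι → Bool) → ℝ} (hw : ∀ x, 0 ≤ w x) (i : ι) :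
    penalizedValue f lam (restrictWt w i false) + penalizedValue f lam (restrictWt w i true) ≤
      (1 + 2 * lam) * penalizedValue f lam w := by
  have hhalf : ∑ x, w x ≤ 2 * penalizedValue f lam w := by
    have h0 := mass_preimage_le_penalizedValue f hl hw false
    have h1 := mass_preimage_le_penalizedValue f hl hw true
    have h := mass_preimage_add f w
    linarith
  have hstep : penalizedValue f lam (restrictWt w i false) +
      penalizedValue f lam (restrictWt w i true) ≤ penalizedValue f lam w + lam * ∑ x, w x := by
    rw [← le_sub_iff_add_le]
    refine ciSup_le fun t0 => ?_
    rw [le_sub_comm]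
    refine ciSup_le fun t1 => ?_
    have h := le_ciSup (bddAbove_penalized f hl hw) (.node i t0 t1)
    simp only [treeScore_node, treeCost_node] at h
    change _ ≤ penalizedValue f lam w at h
    linarith
  nlinarith

theorem exists_tree_treeScore_eq (f : (ι → Bool) → Bool) (w : (ι → Bool) → ℝ)
    (hw : ∀ x, 0 ≤ w x) : ∃ t : DTree ι Unit, treeScore f w t = ∑ x, w x := by
  classical
  obtain ⟨t, ht⟩ := exists_tree_of_dependsOn (Finset.univ : Finset ι) (fun _ => ()) (by simp)
  have hleaf : ∀ x, t.leafSet x = {x} := fun x => by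
    ext y
    refine ⟨fun hy => funext fun i => (ht x).2 y hy i (Finset.mem_univ i), ?_⟩
    rintro rfl
    exact mem_leafSet_self t _
  refine ⟨t, Finset.sum_congr rfl fun x _ => ?_⟩
  have hm : ∀ A : Set (ι → Bool), mass w ({x} ∩ A) = if x ∈ A then w x else 0 := fun A => by
    unfold mass
    rw [Finset.sum_eq_single x]
    · simp [Set.indicator_apply]
    · intro y _ hy
      simp [hy]
    · simp
  have hx : mass w {x} = w x := by simpa using hm Set.univ
  rw [succLeafScore, hleaf, hm, hm, hx]
  rcases eq_or_ne (w x) 0 with h | h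
  · simp [h]
  · cases hf : f x <;> simp [hf, hw x, h]

theorem succRdist_le_expCost (f : (ι → Bool) → Bool) {w : (ι → Bool) → ℝ} (hw : ∀ x, 0 ≤ w x)
    {γ : ℝ} (R : RandAlg ι Unit) (hR : γ ≤ succAlgScore f w R) :
    succRdist f w γ ≤ expCost w R := by
  refine csInf_le ⟨0, ?_⟩ ⟨R, hR, rfl⟩
  rintro _ ⟨R, -, rfl⟩
  exact Finset.sum_nonneg fun j _ => mul_nonneg (R.p_nonneg j) (treeCost_nonneg hw _)

theorem succRdist_le_mix (f : (ι → Bool) → Bool) {w : (ι → Bool) → ℝ} (hw : ∀ x, 0 ≤ w x)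
    {γ p : ℝ} (h0 : 0 ≤ p) (h1 : p ≤ 1) (t1 t0 : DTree ι Unit)
    (h : γ ≤ p * treeScore f w t1 + (1 - p) * treeScore f w t0) :
    succRdist f w γ ≤ p * treeCost w t1 + (1 - p) * treeCost w t0 :=
  (succRdist_le_expCost f hw (mixTwo p h0 h1 t1 t0)
    (h.trans_eq (sum_mixTwo p h0 h1 t1 t0 (treeScore f w)).symm)).trans_eq
    (sum_mixTwo p h0 h1 t1 t0 (treeCost w))

/-- A supporting line of the cost-score trade-off curve at score `γ`. -/
theorem exists_penalizedValue_le (f : (ι → Bool) → Bool) {w : (ι → Bool) → ℝ}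
    (hw : ∀ x, 0 ≤ w x) (hsum : ∑ x, w x = 1) {γ : ℝ} (hγ : γ < 1) (hC : 0 < succRdist f w γ) :
    ∃ lam : ℝ, 0 < lam ∧ penalizedValue f lam w ≤ γ - lam * succRdist f w γ := by
  set C := succRdist f w γ with hCdef
  have hge : ∀ t : DTree ι Unit, γ ≤ treeScore f w t → C ≤ treeCost w t := fun t ht => by
    simpa using succRdist_le_mix f hw zero_le_one le_rfl t t (by simpa using ht)
  have hpair : ∀ t1 t0 : DTree ι Unit, γ < treeScore f w t1 → treeCost w t0 < C →
      (treeScore f w t1 - γ) * (C - treeCost w t0) ≤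
        (γ - treeScore f w t0) * (treeCost w t1 - C) := by
    intro t1 t0 h1 h0
    have hs0 : treeScore f w t0 < γ := by
      by_contra! h
      exact absurd (hge t0 h) (not_le.2 h0)
    have hd : 0 < treeScore f w t1 - treeScore f w t0 := by linarith
    set p := (γ - treeScore f w t0) / (treeScore f w t1 - treeScore f w t0) with hp
    have hpd : p * (treeScore f w t1 - treeScore f w t0) = γ - treeScore f w t0 :=
      div_mul_cancel₀ _ hd.ne'
    have hp0 : 0 ≤ p := div_nonneg (by linarith) hd.le
    have hp1 : p ≤ 1 := (div_le_one hd).2 (by linarith)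
    have hmix := succRdist_le_mix f hw hp0 hp1 t1 t0 (γ := γ) (by linarith)
    have hmul := mul_le_mul_of_nonneg_right hmix hd.le
    have : (p * treeCost w t1 + (1 - p) * treeCost w t0) *
        (treeScore f w t1 - treeScore f w t0) =
        (γ - treeScore f w t0) * (treeCost w t1 - treeCost w t0) +
          treeCost w t0 * (treeScore f w t1 - treeScore f w t0) := by
      rw [← hpd]; ring
    rw [this] at hmul
    nlinarith
  obtain ⟨tf, htf⟩ := exists_tree_treeScore_eq f w hw
  rw [hsum] at htf
  let slope : {t : DTree ι Unit // treeCost w t < C} → ℝ := fun t =>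
    (γ - treeScore f w t.1) / (C - treeCost w t.1)
  have : Nonempty {t : DTree ι Unit // treeCost w t < C} :=
    ⟨⟨.leaf (), by rwa [treeCost_leaf]⟩⟩
  have hgt : ∀ t : DTree ι Unit, γ < treeScore f w t → C < treeCost w t := by
    intro t ht
    refine lt_of_le_of_ne (hge t ht.le) fun h => ?_
    have := hpair t (.leaf ()) ht (by rwa [treeCost_leaf])
    rw [treeCost_leaf, ← h] at this
    nlinarith
  have hlow : ∀ t1 : DTree ι Unit, γ < treeScore f w t1 → ∀ t0,
      (treeScore f w t1 - γ) / (treeCost w t1 - C) ≤ slope t0 := by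
    intro t1 h1 t0
    have h2 := hgt t1 h1
    rw [div_le_div_iff₀ (by linarith) (by linarith [t0.2])]
    exact hpair t1 t0.1 h1 t0.2
  have hfull : γ < treeScore f w tf := by rwa [htf]
  have hbdd : BddBelow (Set.range slope) := ⟨_, by rintro _ ⟨t, rfl⟩; exact hlow tf hfull t⟩
  have hpos : 0 < ⨅ t, slope t :=
    (div_pos (by linarith) (by linarith [hgt tf hfull])).trans_le (le_ciInf (hlow tf hfull))
  refine ⟨⨅ t, slope t, hpos, ciSup_le fun t => ?_⟩
  rcases lt_or_ge (treeCost w t) C with ht | ht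
  · have h := ciInf_le hbdd ⟨t, ht⟩
    rw [le_div_iff₀ (by simpa using ht)] at h
    simp only at h
    linarith
  · rcases lt_or_ge γ (treeScore f w t) with hs | hs
    · have h2 := hgt t hs
      have h := le_ciInf (hlow t hs)
      rw [div_le_iff₀ (by linarith)] at h
      linarith
    · have := mul_nonneg hpos.le (sub_nonneg.2 ht)
      linarith

end Restriction

section DirectProduct

variable {m n : ℕ}

open Classical in
/-- Mass, under the product of the weights `W i`, of the inputs on which the tree computes `fⁿ`. -/
noncomputable def correctMass (f : (Fin m → Bool) → Bool) (W : Fin n → (Fin m → Bool) → ℝ)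
    (t : DTree (Fin n × Fin m) (Fin n → Bool)) : ℝ :=
  ∑ x, (∏ i, W i (block x i)) * if t.out x = fpow f x then 1 else 0

theorem sum_prod_block (W : Fin n → (Fin m → Bool) → ℝ) :
    ∑ x, ∏ i, W i (block x i) = ∏ i, ∑ y, W i y := by
  rw [Fintype.prod_sum]
  exact Fintype.sum_equiv (Equiv.curry _ _ _) _ _ fun x => rfl

theorem correctMass_leaf (f : (Fin m → Bool) → Bool) (W : Fin n → (Fin m → Bool) → ℝ)
    (z : Fin n → Bool) :
    correctMass f W (.leaf z) = ∏ i, mass (W i) {y | f y = z i} := by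
  classical
  unfold mass
  rw [← sum_prod_block]
  refine Finset.sum_congr rfl fun x _ => ?_
  by_cases h : z = fpow f x
  · subst h
    simp [DTree.out, fpow]
  · obtain ⟨i, hi⟩ := Function.ne_iff.1 h
    have hz : Set.indicator {y | f y = z i} (W i) (block x i) = 0 :=
      Set.indicator_of_notMem (s := {y | f y = z i}) (fun hmem => hi (Eq.symm hmem)) _
    rw [Finset.prod_eq_zero (f := fun i => Set.indicator {y | f y = z i} (W i) (block x i))
      (Finset.mem_univ i) hz]
    simp [DTree.out, h]

theorem correctMass_node (f : (Fin m → Bool) → Bool) (W : Fin n → (Fin m → Bool) → ℝ)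
    (q : Fin n × Fin m) (t0 t1 : DTree (Fin n × Fin m) (Fin n → Bool)) :
    correctMass f W (.node q t0 t1) =
      correctMass f (Function.update W q.1 (restrictWt (W q.1) q.2 false)) t0 +
        correctMass f (Function.update W q.1 (restrictWt (W q.1) q.2 true)) t1 := by
  classical
  unfold correctMass
  rw [← Finset.sum_add_distrib]
  refine Finset.sum_congr rfl fun x _ => ?_
  have key : ∀ b, ∏ i, Function.update W q.1 (restrictWt (W q.1) q.2 b) i (block x i) =
      if x q = b then ∏ i, W i (block x i) else 0 := by
    intro b
    split_ifs with h
    · refine Finset.prod_congr rfl fun i _ => ?_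
      by_cases hi : i = q.1
      · subst hi
        simp [restrictWt, block, h]
      · simp [hi]
    · refine Finset.prod_eq_zero (Finset.mem_univ q.1) ?_
      simp [restrictWt, block, h]
  rw [key, key]
  cases h : x q <;> simp [DTree.out, h]

theorem correctMass_le (f : (Fin m → Bool) → Bool) {lam : ℝ} (hl : 0 ≤ lam)
    (t : DTree (Fin n × Fin m) (Fin n → Bool)) :
    ∀ W : Fin n → (Fin m → Bool) → ℝ, (∀ i x, 0 ≤ W i x) →
      correctMass f W t ≤ (1 + 2 * lam) ^ t.depth * ∏ i, penalizedValue f lam (W i) := by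
  induction t with
  | leaf z =>
    intro W hW
    simp only [correctMass_leaf, DTree.depth, pow_zero, one_mul]
    exact Finset.prod_le_prod (fun i _ => mass_nonneg (hW i) _)
      fun i _ => mass_preimage_le_penalizedValue f hl (hW i) _
  | node q t0 t1 ih0 ih1 =>
    intro W hW
    have hnn : ∀ b i x, 0 ≤ Function.update W q.1 (restrictWt (W q.1) q.2 b) i x := by
      intro b i x
      by_cases hi : i = q.1
      · subst hi
        simpa using restrictWt_nonneg (hW _) _ _ x
      · simpa [hi] using hW i x
    have hprod : ∀ b, ∏ i, penalizedValue f lam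
        (Function.update W q.1 (restrictWt (W q.1) q.2 b) i) =
        penalizedValue f lam (restrictWt (W q.1) q.2 b) *
          ∏ i ∈ Finset.univ.erase q.1, penalizedValue f lam (W i) := by
      intro b
      rw [← Finset.mul_prod_erase _ _ (Finset.mem_univ q.1)]
      congr 1
      · simp
      · refine Finset.prod_congr rfl fun i hi => ?_
        simp [Finset.ne_of_mem_erase hi]
    have hb : 1 ≤ 1 + 2 * lam := by linarith
    set D := max t0.depth t1.depth with hD
    set P := ∏ i ∈ Finset.univ.erase q.1, penalizedValue f lam (W i) with hP
    have hP0 : 0 ≤ P := Finset.prod_nonneg fun i _ => penalizedValue_nonneg f hl (hW i)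
    have bound : ∀ (b : Bool) (t : DTree (Fin n × Fin m) (Fin n → Bool)), t.depth ≤ D →
        correctMass f (Function.update W q.1 (restrictWt (W q.1) q.2 b)) t ≤
          (1 + 2 * lam) ^ t.depth *
            ∏ i, penalizedValue f lam (Function.update W q.1 (restrictWt (W q.1) q.2 b) i) →
        correctMass f (Function.update W q.1 (restrictWt (W q.1) q.2 b)) t ≤
          (1 + 2 * lam) ^ D * (penalizedValue f lam (restrictWt (W q.1) q.2 b) * P) := by
      intro b t ht h
      rw [hprod] at h
      refine h.trans (mul_le_mul_of_nonneg_right (pow_le_pow_right₀ hb ht) ?_)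
      exact mul_nonneg (penalizedValue_nonneg f hl (restrictWt_nonneg (hW _) _ _)) hP0
    have b0 := bound false t0 (le_max_left _ _) (ih0 _ (hnn false))
    have b1 := bound true t1 (le_max_right _ _) (ih1 _ (hnn true))
    have hstep := penalizedValue_restrict_add_le f hl (hW q.1) q.2
    rw [correctMass_node, ← Finset.mul_prod_erase _ _ (Finset.mem_univ q.1)]
    calc _ ≤ (1 + 2 * lam) ^ D * (penalizedValue f lam (restrictWt (W q.1) q.2 false) * P) +
          (1 + 2 * lam) ^ D * (penalizedValue f lam (restrictWt (W q.1) q.2 true) * P) :=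
          add_le_add b0 b1
      _ = (1 + 2 * lam) ^ D * ((penalizedValue f lam (restrictWt (W q.1) q.2 false) +
          penalizedValue f lam (restrictWt (W q.1) q.2 true)) * P) := by ring
      _ ≤ (1 + 2 * lam) ^ D * (((1 + 2 * lam) * penalizedValue f lam (W q.1)) * P) := by
          gcongr
      _ = _ := by
          simp only [DTree.depth]
          rw [pow_succ]
          ring

/-- An algorithm attaining the worst-case complexity of the direct product. -/
theorem exists_RwcN_attained (X : Set (Fin m → Bool)) (f : (Fin m → Bool) → Bool) {δ : ℝ}
    (hδ : δ ≤ 1) : ∃ R : RandAlg (Fin n × Fin m) (Fin n → Bool),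
      (∀ x ∈ Xpow n X, δ ≤ ∑ j, R.p j * if (R.T j).out x = fpow f x then 1 else 0) ∧
      ∀ j, R.p j ≠ 0 → (R.T j).depth ≤ RwcN X f n δ := by
  classical
  have triv : ∀ t : DTree (Fin n × Fin m) (Fin n → Bool), t.allLabels fun _ => True := by
    intro t
    induction t with
    | leaf a => trivial
    | node i t0 t1 h0 h1 => exact ⟨h0, h1⟩
  obtain ⟨t, ht⟩ := exists_tree_of_dependsOn (Finset.univ : Finset (Fin n × Fin m)) (fpow f)
    (fun x y h => by rw [funext fun i => h i (Finset.mem_univ i)])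
  obtain ⟨R, -, h1, h2⟩ := Nat.sInf_mem (s := {d : ℕ | ∃ R : RandAlg (Fin n × Fin m) (Fin n → Bool),
    (∀ j, R.p j ≠ 0 → (R.T j).allLabels fun _ => True) ∧
    (∀ x ∈ Xpow n X, δ ≤ ∑ j, if (R.T j).out x = fpow f x then R.p j else 0) ∧
    ∀ j, R.p j ≠ 0 → (R.T j).depth ≤ d})
    ⟨t.depth, mixTwo 1 zero_le_one le_rfl t t, fun _ _ => triv _, fun x _ => by
      have h := sum_mixTwo 1 zero_le_one le_rfl t t fun t => if t.out x = fpow f x then 1 else 0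
      simp only [mul_ite, mul_one, mul_zero] at h
      rw [h]
      simp [(ht x).1, hδ], fun j _ => by
      simp only [mixTwo] at j ⊢
      fin_cases j <;> simp⟩
  refine ⟨R, fun x hx => ?_, ?_⟩
  · simpa using h1 x hx
  · convert h2 using 3
    unfold RwcN RwcTask
    congr!

theorem le_pow_mul_penalizedValue_pow {X : Set (Fin m → Bool)} (f : (Fin m → Bool) → Bool)
    (μ : InputDist (Fin m) X) {δ lam : ℝ} (hδ : δ ≤ 1) (hl : 0 ≤ lam) :
    δ ≤ (1 + 2 * lam) ^ RwcN X f n δ * penalizedValue f lam μ.μ ^ n := by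
  classical
  obtain ⟨R, h1, h2⟩ := exists_RwcN_attained (n := n) X f hδ
  have hU := penalizedValue_nonneg f hl μ.nonneg
  calc δ = ∑ x : Fin n × Fin m → Bool, (∏ i, μ.μ (block x i)) * δ := by
        rw [← Finset.sum_mul, sum_prod_block fun _ => μ.μ]
        simp [μ.sum_one]
    _ ≤ ∑ x : Fin n × Fin m → Bool, (∏ i, μ.μ (block x i)) *
          ∑ j, R.p j * if (R.T j).out x = fpow f x then 1 else 0 := by
        refine Finset.sum_le_sum fun x _ => ?_
        by_cases hx : x ∈ Xpow n X
        · exact mul_le_mul_of_nonneg_left (h1 x hx) (Finset.prod_nonneg fun i _ => μ.nonneg _)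
        · obtain ⟨i, hi⟩ := not_forall.1 hx
          rw [Finset.prod_eq_zero (Finset.mem_univ i) (μ.supp _ hi)]
          simp
    _ = ∑ j, R.p j * correctMass f (fun _ => μ.μ) (R.T j) := by
        simp only [correctMass, Finset.mul_sum]
        rw [Finset.sum_comm]
        refine Finset.sum_congr rfl fun j _ => Finset.sum_congr rfl fun x _ => ?_
        ring
    _ ≤ ∑ j, R.p j * ((1 + 2 * lam) ^ RwcN X f n δ * penalizedValue f lam μ.μ ^ n) := by
        refine Finset.sum_le_sum fun j _ => ?_
        by_cases hj : R.p j = 0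
        · simp [hj]
        refine mul_le_mul_of_nonneg_left ?_ (R.p_nonneg j)
        refine (correctMass_le f hl _ _ fun _ => μ.nonneg).trans ?_
        rw [Finset.prod_const, Finset.card_univ, Fintype.card_fin]
        exact mul_le_mul_of_nonneg_right
          (pow_le_pow_right₀ (by linarith) (h2 j hj)) (pow_nonneg hU n)
    _ = _ := by rw [← Finset.sum_mul, R.p_sum, one_mul]

theorem mul_succRdist_le_RwcN {X : Set (Fin m → Bool)} (f : (Fin m → Bool) → Bool)
    (μ : InputDist (Fin m) X) {γ : ℝ} (h0 : 0 < γ) (h1 : γ < 1) (n : ℕ) :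
    n * succRdist f μ.μ γ ≤ 2 * RwcN X f n (γ ^ n) := by
  rcases le_or_gt (succRdist f μ.μ γ) 0 with hC | hC
  · exact (mul_nonpos_of_nonneg_of_nonpos (Nat.cast_nonneg n) hC).trans (by positivity)
  obtain ⟨lam, hl, hU⟩ := exists_penalizedValue_le f μ.nonneg μ.sum_one h1 hC
  have hmain := le_pow_mul_penalizedValue_pow (n := n) (δ := γ ^ n) f μ
    (pow_le_one₀ h0.le h1.le) hl.le
  set C := succRdist f μ.μ γ
  set d := RwcN X f n (γ ^ n)
  have hexp : penalizedValue f lam μ.μ ≤ γ * Real.exp (-(lam * C)) := by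
    have := Real.add_one_le_exp (-(lam * C))
    nlinarith [mul_pos hl hC]
  have hexp' : 1 + 2 * lam ≤ Real.exp (2 * lam) := by
    linarith [Real.add_one_le_exp (2 * lam)]
  have hle : γ ^ n ≤ γ ^ n * Real.exp (d * (2 * lam) + n * -(lam * C)) := by
    calc γ ^ n ≤ _ := hmain
      _ ≤ Real.exp (2 * lam) ^ d * (γ * Real.exp (-(lam * C))) ^ n := by
          have := penalizedValue_nonneg f hl.le μ.nonneg
          gcongr
      _ = _ := by
          rw [mul_pow, Real.exp_add, Real.exp_nat_mul, Real.exp_nat_mul]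
          ring
  have hone : 1 ≤ Real.exp (d * (2 * lam) + n * -(lam * C)) :=
    le_of_mul_le_mul_left (by simpa using hle) (pow_pos h0 n)
  have hnn := Real.one_le_exp_iff.1 hone
  refine le_of_mul_le_mul_left ?_ hl
  linarith

end DirectProduct

/-- **Optimal direct product theorem, lower bound**: `R_{γⁿ}(fⁿ) ≥ c·n·R̄̄_γ(f)` for a
universal constant `c > 0`, where `R̄̄_γ(f)` is the maximum distributional query complexity
with the success-probability score. -/
theorem optimal_direct_product_lower_bound :
    ∃ c : ℝ, 0 < c ∧
      ∀ (m : ℕ) (X : Set (Fin m → Bool)) (f : (Fin m → Bool) → Bool) (γ : ℝ),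
        1 / 2 < γ → γ < 1 → ∀ n : ℕ, 1 ≤ n →
        c * n * succRmax X f γ ≤ (RwcN X f n (γ ^ n) : ℝ) := by
  refine ⟨1 / 2, by norm_num, fun m X f γ hγ hγ1 n hn => ?_⟩
  have hn0 : (0 : ℝ) < n := by exact_mod_cast hn
  have h : succRmax X f γ ≤ 2 * RwcN X f n (γ ^ n) / n :=
    Real.iSup_le (fun μ => by
      rw [le_div_iff₀ hn0, mul_comm]
      exact mul_succRdist_le_RwcN f μ (by linarith) hγ1 n) (by positivity)
  rw [le_div_iff₀ hn0] at h
  linarith
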